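/- arXiv:1701.03195 — 2 statements merged into one kernel-verified Lean document; each statement's English description precedes it below -/
import Mathlib

section
/- Second derivative of the exponent function E_h at s = 0: Let W be a classical-quantum channel with finite input alphabet X and outputs density operators on ℂ^d, let σ be a positive definite density operator on ℂ^d, and let P be a probability distribution on X. Then the function s ↦ E_h(s,P,σ) := −(1+s)·Σ_{x:P(x)>0} P(x)·log Tr[W_x^{1/(1+s)} σ^{s/(1+s)}] is twice differentiable from the right at s = 0 with second derivative equal to −Σ_{x:P(x)>0} P(x)·V(W_x‖σ). -/
open scoped BigOperators ComplexOrder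
open Filter

noncomputable section

namespace MDQ

/-- Functional calculus for Hermitian matrices (junk value `0` otherwise). -/
noncomputable def matFun {d : ℕ} (f : ℝ → ℝ) (A : Matrix (Fin d) (Fin d) ℂ) :
    Matrix (Fin d) (Fin d) ℂ :=
  if hA : A.IsHermitian then hA.cfc f else 0

/-- Matrix logarithm on the support (`Real.log 0 = 0`). -/
noncomputable def mlog {d : ℕ} (A : Matrix (Fin d) (Fin d) ℂ) : Matrix (Fin d) (Fin d) ℂ :=
  matFun Real.log A

/-- Matrix real power, restricted to the support. -/
noncomputable def mpow {d : ℕ} (A : Matrix (Fin d) (Fin d) ℂ) (p : ℝ) :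
    Matrix (Fin d) (Fin d) ℂ :=
  matFun (fun t => if t = 0 then 0 else t ^ p) A

/-- Matrix exponential via functional calculus. -/
noncomputable def mexp {d : ℕ} (A : Matrix (Fin d) (Fin d) ℂ) : Matrix (Fin d) (Fin d) ℂ :=
  matFun Real.exp A

/-- Orthogonal projection onto the support of a Hermitian matrix. -/
noncomputable def suppProj {d : ℕ} (A : Matrix (Fin d) (Fin d) ℂ) : Matrix (Fin d) (Fin d) ℂ :=
  matFun (fun t => if t = 0 then 0 else 1) A

/-- `A` is a density operator. -/
def IsDensity {d : ℕ} (A : Matrix (Fin d) (Fin d) ℂ) : Prop :=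
  A.PosSemidef ∧ A.trace = 1

/-- Real part of the trace. -/
noncomputable def reTr {ι : Type} [Fintype ι] (A : Matrix ι ι ℂ) : ℝ :=
  A.trace.re

/-- supp ρ ⊆ supp σ, phrased via ranges of the associated linear maps. -/
def SuppLE {d : ℕ} (ρ σ : Matrix (Fin d) (Fin d) ℂ) : Prop :=
  LinearMap.range (Matrix.toLin' ρ) ≤ LinearMap.range (Matrix.toLin' σ)

/-- Quantum relative entropy `D(ρ‖σ)`. -/
noncomputable def qD {d : ℕ} (ρ σ : Matrix (Fin d) (Fin d) ℂ) : ℝ :=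
  reTr (ρ * (mlog ρ - mlog σ))

/-- Quantum relative entropy variance `V(ρ‖σ)`. -/
noncomputable def qV {d : ℕ} (ρ σ : Matrix (Fin d) (Fin d) ℂ) : ℝ :=
  reTr (ρ * (mlog ρ - mlog σ) ^ 2) - (qD ρ σ) ^ 2

/-- The variant relative entropy variance `Ṽ(ρ‖σ)`. -/
noncomputable def qVtilde {d : ℕ} (ρ σ : Matrix (Fin d) (Fin d) ℂ) : ℝ :=
  (∫ t in (0:ℝ)..1,
    reTr (mpow ρ (1 - t) * (mlog ρ - mlog σ) * mpow ρ t * (mlog ρ - mlog σ))) - (qD ρ σ) ^ 2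

/-- The quantum Rényi divergence of order zero, `D₀(ρ‖σ) = -log Tr[Π_ρ σ]`. -/
noncomputable def qD0 {d : ℕ} (ρ σ : Matrix (Fin d) (Fin d) ℂ) : ℝ :=
  - Real.log (reTr (suppProj ρ * σ))

/-- Tensor product of a finite family of `d × d` matrices. -/
noncomputable def tensorSeq {d n : ℕ} (A : Fin n → Matrix (Fin d) (Fin d) ℂ) :
    Matrix (Fin n → Fin d) (Fin n → Fin d) ℂ :=
  Matrix.of fun i j => ∏ k, A k (i k) (j k)

/-- `n`-fold tensor power of a matrix. -/
noncomputable def tensorPow {d : ℕ} (A : Matrix (Fin d) (Fin d) ℂ) (n : ℕ) :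
    Matrix (Fin n → Fin d) (Fin n → Fin d) ℂ :=
  tensorSeq (fun _ => A)

/-- Smallest type-I error with type-II error at most `μ`:  `α̂_μ(ρ‖σ)`. -/
noncomputable def hypoErr {ι : Type} [Fintype ι] [DecidableEq ι]
    (ρ σ : Matrix ι ι ℂ) (μ : ℝ) : ℝ :=
  sInf { a : ℝ | ∃ Q : Matrix ι ι ℂ, Q.PosSemidef ∧ (1 - Q).PosSemidef ∧
    reTr (Q * σ) ≤ μ ∧ a = reTr ((1 - Q) * ρ) }

/-- `P` is a probability distribution on a finite alphabet. -/
def IsProbDist {X : Type} [Fintype X] (P : X → ℝ) : Prop :=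
  (∀ x, 0 ≤ P x) ∧ ∑ x, P x = 1

/-- The average output state `PW`. -/
noncomputable def avgState {X : Type} [Fintype X] {d : ℕ}
    (P : X → ℝ) (W : X → Matrix (Fin d) (Fin d) ℂ) : Matrix (Fin d) (Fin d) ℂ :=
  ∑ x, (P x : ℂ) • W x

/-- Mutual information `I(P, W)`. -/
noncomputable def mutualInfo {X : Type} [Fintype X] {d : ℕ}
    (P : X → ℝ) (W : X → Matrix (Fin d) (Fin d) ℂ) : ℝ :=
  ∑ x, P x * qD (W x) (avgState P W)

/-- Capacity `C_W`. -/
noncomputable def capacity {X : Type} [Fintype X] {d : ℕ}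
    (W : X → Matrix (Fin d) (Fin d) ℂ) : ℝ :=
  sSup { c : ℝ | ∃ P : X → ℝ, IsProbDist P ∧ c = mutualInfo P W }

/-- Conditional information variance `V(P, W)`. -/
noncomputable def infoVar {X : Type} [Fintype X] {d : ℕ}
    (P : X → ℝ) (W : X → Matrix (Fin d) (Fin d) ℂ) : ℝ :=
  ∑ x, P x * qV (W x) (avgState P W)

/-- The variant conditional information variance `Ṽ(P, W)`. -/
noncomputable def infoVarTilde {X : Type} [Fintype X] {d : ℕ}
    (P : X → ℝ) (W : X → Matrix (Fin d) (Fin d) ℂ) : ℝ :=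
  ∑ x, P x * qVtilde (W x) (avgState P W)

/-- Minimal peripheral information variance `V_W`. -/
noncomputable def Vmin {X : Type} [Fintype X] {d : ℕ}
    (W : X → Matrix (Fin d) (Fin d) ℂ) : ℝ :=
  sInf { v : ℝ | ∃ P : X → ℝ, IsProbDist P ∧ mutualInfo P W = capacity W ∧ v = infoVar P W }

/-- Minimal variant peripheral information variance `Ṽ_W`. -/
noncomputable def VminTilde {X : Type} [Fintype X] {d : ℕ}
    (W : X → Matrix (Fin d) (Fin d) ℂ) : ℝ :=
  sInf { v : ℝ | ∃ P : X → ℝ, IsProbDist P ∧ mutualInfo P W = capacity W ∧ v = infoVarTilde P W }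

/-- Conditional relative entropy `D(W‖σ|P)`. -/
noncomputable def Dcond {X : Type} [Fintype X] {d : ℕ}
    (W : X → Matrix (Fin d) (Fin d) ℂ) (σ : Matrix (Fin d) (Fin d) ℂ) (P : X → ℝ) : ℝ :=
  ∑ x, P x * qD (W x) σ

/-- Conditional relative entropy variance `V(W‖σ|P)`. -/
noncomputable def Vcond {X : Type} [Fintype X] {d : ℕ}
    (W : X → Matrix (Fin d) (Fin d) ℂ) (σ : Matrix (Fin d) (Fin d) ℂ) (P : X → ℝ) : ℝ :=
  ∑ x, P x * qV (W x) σ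

/-- Conditional order-zero Rényi divergence `D₀(W‖σ|P)`. -/
noncomputable def D0cond {X : Type} [Fintype X] {d : ℕ}
    (W : X → Matrix (Fin d) (Fin d) ℂ) (σ : Matrix (Fin d) (Fin d) ℂ) (P : X → ℝ) : ℝ :=
  ∑ x, P x * qD0 (W x) σ

/-- The exponent function `E_h(s, P, σ)`. -/
noncomputable def Eh {X : Type} [Fintype X] {d : ℕ}
    (W : X → Matrix (Fin d) (Fin d) ℂ) (s : ℝ) (P : X → ℝ)
    (σ : Matrix (Fin d) (Fin d) ℂ) : ℝ :=
  -(1 + s) * ∑ x, P x * Real.log (reTr (mpow (W x) (1 / (1 + s)) * mpow σ (s / (1 + s))))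

/-- The log-Euclidean exponent function `Ẽ_h(s, P, σ)`. -/
noncomputable def EhTilde {X : Type} [Fintype X] {d : ℕ}
    (W : X → Matrix (Fin d) (Fin d) ℂ) (s : ℝ) (P : X → ℝ)
    (σ : Matrix (Fin d) (Fin d) ℂ) : ℝ :=
  -(1 + s) * ∑ x, P x *
    Real.log (reTr (mexp ((((1 + s)⁻¹ : ℝ) : ℂ) • (mlog (W x) + ((s : ℝ) : ℂ) • mlog σ))))

/-- The modified auxiliary function `Ẽ₀(s, P, σ)`. -/
noncomputable def E0Tilde {X : Type} [Fintype X] {d : ℕ}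
    (W : X → Matrix (Fin d) (Fin d) ℂ) (s : ℝ) (P : X → ℝ)
    (σ : Matrix (Fin d) (Fin d) ℂ) : ℝ :=
  - Real.log (∑ x, P x * reTr (mpow (W x) (1 - s) * mpow σ s))

/-- The sphere-packing exponent `E_sp^{(2)}(R, P, σ)`. -/
noncomputable def Esp2 {X : Type} [Fintype X] {d : ℕ}
    (W : X → Matrix (Fin d) (Fin d) ℂ) (R : ℝ) (P : X → ℝ)
    (σ : Matrix (Fin d) (Fin d) ℂ) : ℝ :=
  sSup { e : ℝ | ∃ s : ℝ, 0 ≤ s ∧ e = Eh W s P σ - s * R }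

/-- The sphere-packing exponent `Ẽ_sp(R, P, σ)`. -/
noncomputable def EspTilde {X : Type} [Fintype X] {d : ℕ}
    (W : X → Matrix (Fin d) (Fin d) ℂ) (R : ℝ) (P : X → ℝ)
    (σ : Matrix (Fin d) (Fin d) ℂ) : ℝ :=
  sSup { e : ℝ | ∃ s : ℝ, 0 ≤ s ∧ e = EhTilde W s P σ - s * R }

open Classical in
/-- Empirical distribution of a word `x^n ∈ X^n`. -/
noncomputable def empDist {X : Type} [Fintype X] {n : ℕ} (xs : Fin n → X) (x : X) : ℝ :=
  ((Finset.univ.filter fun i => xs i = x).card : ℝ) / n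

/-- Smallest average error probability `ε*(n, R)` over all `n`-blocklength codes with
`⌈exp (n R)⌉` messages. -/
noncomputable def optErr {X : Type} [Fintype X] {d : ℕ}
    (W : X → Matrix (Fin d) (Fin d) ℂ) (n : ℕ) (R : ℝ) : ℝ :=
  sInf { e : ℝ | ∃ (f : Fin ⌈Real.exp (n * R)⌉₊ → Fin n → X)
    (Pov : Fin ⌈Real.exp (n * R)⌉₊ → Matrix (Fin n → Fin d) (Fin n → Fin d) ℂ),
    (∀ m, (Pov m).PosSemidef) ∧ (∑ m, Pov m) = 1 ∧
    e = (1 / (⌈Real.exp (n * R)⌉₊ : ℝ)) *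
      ∑ m, (1 - reTr (Pov m * tensorSeq (fun k => W (f m k)))) }

/-- The binary entropy function. -/
noncomputable def binEnt (p : ℝ) : ℝ :=
  -p * Real.log p - (1 - p) * Real.log (1 - p)

lemma matFun_mul {d : ℕ} (f g : ℝ → ℝ) (A : Matrix (Fin d) (Fin d) ℂ) :
    matFun f A * matFun g A = matFun (fun t => f t * g t) A := by
  unfold matFun
  split_ifs with hA
  · simp only [Matrix.IsHermitian.cfc, ← map_mul, Matrix.diagonal_mul_diagonal]
    congr 2
    ext i
    simp
  · simp

lemma matFun_id {d : ℕ} {A : Matrix (Fin d) (Fin d) ℂ} (hA : A.IsHermitian) :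
    matFun (fun t => t) A = A := by
  rw [matFun, dif_pos hA]
  exact hA.spectral_theorem.symm

lemma matFun_one {d : ℕ} {A : Matrix (Fin d) (Fin d) ℂ} (hA : A.IsHermitian) :
    matFun (fun _ => 1) A = 1 := by
  rw [matFun, dif_pos hA, Matrix.IsHermitian.cfc]
  have : (RCLike.ofReal ∘ (fun _ : ℝ => (1 : ℝ)) ∘ hA.eigenvalues : Fin d → ℂ) = fun _ => 1 := by
    ext i; simp
  rw [this, Matrix.diagonal_one, map_one]

/-- Squared overlaps of the eigenvectors of two Hermitian matrices. -/
def overlap {d : ℕ} {A B : Matrix (Fin d) (Fin d) ℂ} (hA : A.IsHermitian) (hB : B.IsHermitian)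
    (i j : Fin d) : ℝ :=
  Complex.normSq ((star (hA.eigenvectorUnitary : Matrix (Fin d) (Fin d) ℂ) *
    (hB.eigenvectorUnitary : Matrix (Fin d) (Fin d) ℂ)) i j)

lemma trace_diagonal_mul_conj {d : ℕ} (M : Matrix (Fin d) (Fin d) ℂ) (a b : Fin d → ℂ) :
    (Matrix.diagonal a * M * Matrix.diagonal b * star M).trace =
      ∑ i, ∑ j, (Complex.normSq (M i j) : ℂ) * (a i * b j) := by
  simp only [Matrix.trace, Matrix.diag, Matrix.mul_apply (N := star M), Matrix.mul_diagonal,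
    Matrix.diagonal_mul, Matrix.star_apply, Complex.star_def, Complex.normSq_eq_conj_mul_self]
  exact Finset.sum_congr rfl fun i _ => Finset.sum_congr rfl fun j _ => by ring

lemma reTr_matFun_mul_matFun {d : ℕ} {A B : Matrix (Fin d) (Fin d) ℂ}
    (hA : A.IsHermitian) (hB : B.IsHermitian) (f g : ℝ → ℝ) :
    reTr (matFun f A * matFun g B) =
      ∑ i, ∑ j, overlap hA hB i j * (f (hA.eigenvalues i) * g (hB.eigenvalues j)) := by
  have key : (matFun f A * matFun g B).trace = ((∑ i, ∑ j, overlap hA hB i j *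
      (f (hA.eigenvalues i) * g (hB.eigenvalues j)) : ℝ) : ℂ) := by
    rw [matFun, matFun, dif_pos hA, dif_pos hB, Matrix.IsHermitian.cfc, Matrix.IsHermitian.cfc,
      Unitary.conjStarAlgAut_apply, Unitary.conjStarAlgAut_apply]
    set U : Matrix (Fin d) (Fin d) ℂ := ↑hA.eigenvectorUnitary with hU
    set V : Matrix (Fin d) (Fin d) ℂ := ↑hB.eigenvectorUnitary with hV
    have h := trace_diagonal_mul_conj (star U * V)
      (RCLike.ofReal ∘ f ∘ hA.eigenvalues) (RCLike.ofReal ∘ g ∘ hB.eigenvalues)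
    simp only [star_mul, star_star] at h
    rw [Matrix.mul_assoc U, Matrix.mul_assoc U, Matrix.trace_mul_comm U]
    simp only [Matrix.mul_assoc] at h ⊢
    rw [h]
    simp [overlap, hU, hV]
  rw [reTr, key, Complex.ofReal_re]

/-- `Tr[ρ^{1-t} σ^t]` as a finite combination of exponentials in `t`. -/
lemma reTr_mpow_mul_mpow {d : ℕ} {ρ σ : Matrix (Fin d) (Fin d) ℂ} (hρ : ρ.PosSemidef)
    (hσ : σ.PosDef) (t : ℝ) :
    reTr (mpow ρ (1 - t) * mpow σ t) =
      ∑ i, ∑ j, overlap hρ.1 hσ.1 i j * (hρ.1.eigenvalues i *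
        Real.exp (t * (Real.log (hσ.1.eigenvalues j) - Real.log (hρ.1.eigenvalues i)))) := by
  rw [mpow, mpow, reTr_matFun_mul_matFun hρ.1 hσ.1]
  refine Finset.sum_congr rfl fun i _ => Finset.sum_congr rfl fun j _ => ?_
  have hj := hσ.eigenvalues_pos j
  rw [if_neg hj.ne']
  split_ifs with hi
  · simp [hi]
  · have hi' : 0 < hρ.1.eigenvalues i := lt_of_le_of_ne (hρ.eigenvalues_nonneg i) (Ne.symm hi)
    rw [Real.rpow_sub hi', Real.rpow_one, Real.rpow_def_of_pos hi', Real.rpow_def_of_pos hj,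
      mul_sub, Real.exp_sub, mul_comm t, mul_comm t]
    ring

lemma sum_overlap_eq_one {d : ℕ} {ρ σ : Matrix (Fin d) (Fin d) ℂ} (hρ : IsDensity ρ)
    (hσ : σ.IsHermitian) :
    ∑ i, ∑ j, overlap hρ.1.1 hσ i j * hρ.1.1.eigenvalues i = 1 := by
  have h := reTr_matFun_mul_matFun hρ.1.1 hσ (fun t => t) (fun _ => 1)
  rw [matFun_id hρ.1.1, matFun_one hσ, Matrix.mul_one] at h
  simpa [reTr, hρ.2] using h.symm

lemma sum_overlap_log {d : ℕ} {ρ σ : Matrix (Fin d) (Fin d) ℂ} (hρ : ρ.IsHermitian)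
    (hσ : σ.IsHermitian) :
    ∑ i, ∑ j, overlap hρ hσ i j * (hρ.eigenvalues i *
        (Real.log (hσ.eigenvalues j) - Real.log (hρ.eigenvalues i))) = -qD ρ σ := by
  have h1 := reTr_matFun_mul_matFun hρ hσ (fun t => t * Real.log t) (fun _ => 1)
  have h2 := reTr_matFun_mul_matFun hρ hσ (fun t => t) Real.log
  rw [matFun_one hσ, Matrix.mul_one, ← matFun_mul, matFun_id hρ] at h1
  rw [matFun_id hρ] at h2
  have h3 : qD ρ σ = reTr (ρ * matFun Real.log ρ) - reTr (ρ * matFun Real.log σ) := by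
    simp [qD, mlog, reTr, Matrix.mul_sub]
  rw [h3, h1, h2, neg_sub]
  simp only [← Finset.sum_sub_distrib]
  exact Finset.sum_congr rfl fun i _ => Finset.sum_congr rfl fun j _ => by ring

lemma sum_overlap_log_sq {d : ℕ} {ρ σ : Matrix (Fin d) (Fin d) ℂ} (hρ : ρ.IsHermitian)
    (hσ : σ.IsHermitian) :
    ∑ i, ∑ j, overlap hρ hσ i j * (hρ.eigenvalues i *
        (Real.log (hσ.eigenvalues j) - Real.log (hρ.eigenvalues i)) ^ 2) =
      reTr (ρ * (mlog ρ - mlog σ) ^ 2) := by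
  have h1 := reTr_matFun_mul_matFun hρ hσ (fun t => t * Real.log t * Real.log t) (fun _ => 1)
  have h2 := reTr_matFun_mul_matFun hρ hσ (fun t => t * Real.log t) Real.log
  have h3 := reTr_matFun_mul_matFun hρ hσ (fun t => t) (fun t => Real.log t * Real.log t)
  have hcomm : mlog ρ * ρ = ρ * mlog ρ := by
    conv_lhs => rw [← matFun_id hρ, matFun_id hρ, mlog]
    conv_lhs => enter [2]; rw [← matFun_id hρ]
    conv_rhs => enter [1]; rw [← matFun_id hρ]
    rw [mlog, matFun_mul, matFun_mul]
    simp only [mul_comm]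
  rw [matFun_one hσ, Matrix.mul_one, ← matFun_mul, ← matFun_mul, matFun_id hρ] at h1
  rw [← matFun_mul, matFun_id hρ] at h2
  rw [← matFun_mul, matFun_id hρ] at h3
  have hcyc : (ρ * (mlog σ * mlog ρ)).trace = (ρ * mlog ρ * mlog σ).trace := by
    rw [← Matrix.mul_assoc, Matrix.trace_mul_comm, ← Matrix.mul_assoc, hcomm]
  have h4 : reTr (ρ * (mlog ρ - mlog σ) ^ 2) = reTr (ρ * mlog ρ * mlog ρ) -
      2 * reTr (ρ * mlog ρ * mlog σ) + reTr (ρ * (mlog σ * mlog σ)) := by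
    simp only [reTr, pow_two, Matrix.mul_sub, Matrix.sub_mul, Matrix.trace_sub, hcyc,
      Complex.sub_re, Matrix.mul_assoc]
    simp only [← Matrix.mul_assoc ρ (mlog ρ) (mlog σ)]
    ring
  simp only [mlog] at h4 ⊢
  rw [h4, h1, h2, h3, Finset.mul_sum]
  simp only [Finset.mul_sum, ← Finset.sum_sub_distrib, ← Finset.sum_add_distrib]
  exact Finset.sum_congr rfl fun i _ => Finset.sum_congr rfl fun j _ => by ring

/-- The first derivative near `0` and second derivative at `0` of
`s ↦ -(1 + s) log φ(s / (1 + s))`. -/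
lemma hasDerivAt_perspective_log {φ φ' : ℝ → ℝ} {c : ℝ} (hφ : ∀ t, HasDerivAt φ (φ' t) t)
    (hφ' : HasDerivAt φ' c 0) (h0 : φ 0 = 1) :
    ∃ h : ℝ → ℝ, (∀ᶠ s in nhds (0 : ℝ),
      HasDerivAt (fun s => -(1 + s) * Real.log (φ (s / (1 + s)))) (h s) s) ∧
      HasDerivAt h (-(c - φ' 0 ^ 2)) 0 := by
  have hτ : ∀ s : ℝ, 1 + s ≠ 0 → HasDerivAt (fun s => s / (1 + s)) (1 / (1 + s) ^ 2) s := by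
    intro s hs
    refine ((hasDerivAt_id' s).fun_div ((hasDerivAt_id' s).const_add 1) hs).congr_deriv ?_
    simp
  have hτ0 := hτ 0 (by norm_num)
  have hφτ0 : HasDerivAt (fun s : ℝ => φ (s / (1 + s))) (φ' 0) 0 := by
    have := HasDerivAt.comp (0 : ℝ) (h₂ := φ) (hφ _) hτ0
    simpa [Function.comp_def] using this
  have hφ'τ0 : HasDerivAt (fun s : ℝ => φ' (s / (1 + s))) c 0 := by
    have := HasDerivAt.comp (0 : ℝ) (h₂ := φ') (h₂' := c) (by simpa using hφ') hτ0
    simpa [Function.comp_def] using this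
  have hval : φ (0 / (1 + 0)) = 1 := by simpa using h0
  refine ⟨fun s => -(Real.log (φ (s / (1 + s))) +
    φ' (s / (1 + s)) / φ (s / (1 + s)) / (1 + s)), ?_, ?_⟩
  · have e1 : ∀ᶠ s in nhds (0 : ℝ), φ (s / (1 + s)) ≠ 0 :=
      hφτ0.continuousAt.eventually_ne (by simp [h0])
    have e2 : ∀ᶠ s in nhds (0 : ℝ), 1 + s ≠ 0 :=
      (by fun_prop : Continuous fun s : ℝ => 1 + s).continuousAt.eventually_ne (by simp)
    filter_upwards [e1, e2] with s h1 h2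
    have hlog := ((hφ (s / (1 + s))).comp s (hτ s h2)).log h1
    refine ((((hasDerivAt_id' s).const_add 1).fun_neg).fun_mul hlog).congr_deriv ?_
    simp only [Function.comp_apply]
    field_simp
    ring
  · have hlog := hφτ0.log (by simp [h0])
    have hq := (hφ'τ0.fun_div hφτ0 (by simp [h0])).fun_div
      ((hasDerivAt_id' (0 : ℝ)).const_add 1) (by norm_num)
    refine (hlog.fun_add hq).fun_neg.congr_deriv ?_
    simp [h0]
    ring

/-- **Second (right) derivative of the exponent function `E_h` at `s = 0`.** -/
theorem Eh_second_derivWithin_zero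
    {X : Type} [Fintype X] {d : ℕ}
    (W : X → Matrix (Fin d) (Fin d) ℂ) (hW : ∀ x, IsDensity (W x))
    (σ : Matrix (Fin d) (Fin d) ℂ) (hσ : σ.PosDef ∧ σ.trace = 1)
    (P : X → ℝ) (hP : IsProbDist P) :
    HasDerivWithinAt (derivWithin (fun s => Eh W s P σ) (Set.Ici 0))
      (-(∑ x, P x * qV (W x) σ)) (Set.Ici 0) 0 := by
  have hx : ∀ x, ∃ h : ℝ → ℝ, (∀ᶠ s in nhds (0 : ℝ), HasDerivAt
      (fun s => -(1 + s) * Real.log (reTr (mpow (W x) (1 - s / (1 + s)) * mpow σ (s / (1 + s)))))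
      (h s) s) ∧ HasDerivAt h (-qV (W x) σ) 0 := by
    intro x
    set hA := (hW x).1.1
    have hexp : ∀ k t : ℝ, HasDerivAt (fun t => Real.exp (t * k)) (Real.exp (t * k) * k) t :=
      fun k t => by simpa using ((hasDerivAt_id t).mul_const k).exp
    have h1 : ∀ t, HasDerivAt (fun t => reTr (mpow (W x) (1 - t) * mpow σ t))
        (∑ i, ∑ j, overlap hA hσ.1.1 i j * (hA.eigenvalues i *
          (Real.exp (t * (Real.log (hσ.1.1.eigenvalues j) - Real.log (hA.eigenvalues i))) *
            (Real.log (hσ.1.1.eigenvalues j) - Real.log (hA.eigenvalues i))))) t := by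
      intro t
      rw [funext (reTr_mpow_mul_mpow (hW x).1 hσ.1)]
      exact HasDerivAt.fun_sum fun i _ => HasDerivAt.fun_sum fun j _ =>
        ((hexp _ t).const_mul _).const_mul _
    have h2 := HasDerivAt.fun_sum (u := Finset.univ) fun i _ =>
      HasDerivAt.fun_sum (u := Finset.univ) fun j _ =>
        (((hexp (Real.log (hσ.1.1.eigenvalues j) - Real.log (hA.eigenvalues i)) 0).mul_const
          (Real.log (hσ.1.1.eigenvalues j) - Real.log (hA.eigenvalues i))).const_mul
            (hA.eigenvalues i)).const_mul (overlap hA hσ.1.1 i j)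
    have h0 : reTr (mpow (W x) (1 - 0) * mpow σ 0) = 1 := by
      rw [reTr_mpow_mul_mpow (hW x).1 hσ.1]
      simpa using sum_overlap_eq_one (hW x) hσ.1.1
    obtain ⟨h, ha, hb⟩ := hasDerivAt_perspective_log h1 h2 h0
    refine ⟨h, ha, ?_⟩
    convert hb using 1
    simp only [zero_mul, Real.exp_zero, one_mul, ← pow_two]
    rw [sum_overlap_log, sum_overlap_log_sq, qV, neg_sq]
  choose h hh hh' using hx
  have hE : ∀ᶠ s in nhds (0 : ℝ),
      HasDerivAt (fun s => Eh W s P σ) (∑ x, P x * h x s) s := by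
    have hne : ∀ᶠ s in nhds (0 : ℝ), 1 + s ≠ 0 :=
      (by fun_prop : Continuous fun s : ℝ => 1 + s).continuousAt.eventually_ne (by simp)
    filter_upwards [eventually_all.2 hh, hne.eventually_nhds] with s hs hs'
    refine (HasDerivAt.fun_sum (u := Finset.univ)
      fun x _ => (hs x).const_mul (P x)).congr_of_eventuallyEq ?_
    filter_upwards [hs'] with r hr
    rw [Eh, Finset.mul_sum]
    refine Finset.sum_congr rfl fun x _ => ?_
    rw [show 1 / (1 + r) = 1 - r / (1 + r) by field_simp; ring]
    ring
  have hsum : HasDerivAt (fun s => ∑ x, P x * h x s) (-(∑ x, P x * qV (W x) σ)) 0 := by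
    simpa using HasDerivAt.fun_sum (u := Finset.univ) fun x _ => (hh' x).const_mul (P x)
  have heq : ∀ᶠ s in nhdsWithin (0 : ℝ) (Set.Ici 0),
      derivWithin (fun s => Eh W s P σ) (Set.Ici 0) s = ∑ x, P x * h x s := by
    filter_upwards [hE.filter_mono nhdsWithin_le_nhds, self_mem_nhdsWithin] with s hs hs0
    exact hs.hasDerivWithinAt.derivWithin (uniqueDiffOn_Ici 0 s hs0)
  exact hsum.hasDerivWithinAt.congr_of_eventuallyEq heq (heq.self_of_nhdsWithin Set.self_mem_Ici)

end MDQ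
end
end

section
/- Concavity of the log-Euclidean exponent function Ẽ_h: Let W be a classical-quantum channel with finite input alphabet X whose outputs W_x are positive definite density operators on ℂ^d, let σ be a positive definite density operator on ℂ^d, and let P be a probability distribution on X. Then the function s ↦ Ẽ_h(s,P,σ) := −(1+s)·Σ_{x:P(x)>0} P(x)·log Tr[exp((log W_x + s·log σ)/(1+s))] is concave on [0, +∞). -/
open scoped BigOperators ComplexOrder
open Filter

noncomputable section

namespace MDQ

lemma isHermitian_matFun {d : ℕ} (f : ℝ → ℝ) (A : Matrix (Fin d) (Fin d) ℂ) :
    (matFun f A).IsHermitian := by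
  unfold matFun
  split_ifs with hA
  · rw [← hA.cfc_eq]
    exact cfc_predicate f A
  · exact Matrix.isHermitian_zero

lemma reTr_mexp {d : ℕ} {A : Matrix (Fin d) (Fin d) ℂ} (hA : A.IsHermitian) :
    reTr (mexp A) = ∑ i, Real.exp (hA.eigenvalues i) := by
  rw [reTr, mexp, matFun, dif_pos hA, Matrix.IsHermitian.cfc, Unitary.conjStarAlgAut_apply,
    Matrix.trace_mul_cycle, Unitary.coe_star_mul_self, one_mul, Matrix.trace_diagonal,
    Complex.re_sum]
  exact Finset.sum_congr rfl fun i _ => Complex.ofReal_re _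

lemma reTr_mexp_pos {d : ℕ} (hd : d ≠ 0) {A : Matrix (Fin d) (Fin d) ℂ} (hA : A.IsHermitian) :
    0 < reTr (mexp A) := by
  have : NeZero d := ⟨hd⟩
  rw [reTr_mexp hA]
  exact Finset.sum_pos (fun i _ => Real.exp_pos _) Finset.univ_nonempty

/-- The squared moduli of the entries in a row of a unitary matrix sum to one. -/
lemma sum_normSq_row {d : ℕ} (M : Matrix.unitaryGroup (Fin d) ℂ) (i : Fin d) :
    ∑ j, Complex.normSq ((M : Matrix (Fin d) (Fin d) ℂ) i j) = 1 := by
  have h := congrFun (congrFun (Unitary.coe_mul_star_self M) i) i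
  rw [Matrix.mul_apply, Matrix.one_apply_eq] at h
  rw [← Complex.ofReal_inj, Complex.ofReal_sum, Complex.ofReal_one, ← h]
  exact Finset.sum_congr rfl fun j _ => (Complex.mul_conj _).symm

/-- The squared moduli of the entries in a column of a unitary matrix sum to one. -/
lemma sum_normSq_col {d : ℕ} (M : Matrix.unitaryGroup (Fin d) ℂ) (j : Fin d) :
    ∑ i, Complex.normSq ((M : Matrix (Fin d) (Fin d) ℂ) i j) = 1 := by
  rw [← sum_normSq_row (star M) j]
  exact Finset.sum_congr rfl fun i _ => (Complex.normSq_conj _).symm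

/-- Diagonal entries of a unitary conjugate of a Hermitian matrix in terms of its eigenvalues. -/
lemma conj_diag_re {d : ℕ} {K : Matrix (Fin d) (Fin d) ℂ} (hK : K.IsHermitian)
    (U : Matrix.unitaryGroup (Fin d) ℂ) (i : Fin d) :
    ((star (U : Matrix (Fin d) (Fin d) ℂ) * K * U) i i).re =
      ∑ j, Complex.normSq (((star U * hK.eigenvectorUnitary : Matrix.unitaryGroup (Fin d) ℂ) :
        Matrix (Fin d) (Fin d) ℂ) i j) * hK.eigenvalues j := by
  set M : Matrix.unitaryGroup (Fin d) ℂ := star U * hK.eigenvectorUnitary with hM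
  have h : star (U : Matrix (Fin d) (Fin d) ℂ) * K * (U : Matrix (Fin d) (Fin d) ℂ) =
      (M : Matrix (Fin d) (Fin d) ℂ) * Matrix.diagonal (RCLike.ofReal ∘ hK.eigenvalues) *
        star (M : Matrix (Fin d) (Fin d) ℂ) := by
    conv_lhs => rw [hK.spectral_theorem, Unitary.conjStarAlgAut_apply]
    simp [hM, mul_assoc]
  rw [h, Matrix.mul_apply, Complex.re_sum]
  refine Finset.sum_congr rfl fun j _ => ?_
  rw [Matrix.mul_diagonal, Matrix.star_apply, mul_right_comm, RCLike.star_def, Complex.mul_conj]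
  simp

/-- **Peierls inequality**: exponentials of diagonal entries are dominated by the trace of the
exponential. -/
lemma sum_exp_conj_diag_le {d : ℕ} {K : Matrix (Fin d) (Fin d) ℂ} (hK : K.IsHermitian)
    (U : Matrix.unitaryGroup (Fin d) ℂ) :
    ∑ i, Real.exp ((star (U : Matrix (Fin d) (Fin d) ℂ) * K * U) i i).re ≤ reTr (mexp K) := by
  set M : Matrix.unitaryGroup (Fin d) ℂ := star U * hK.eigenvectorUnitary
  calc ∑ i, Real.exp ((star (U : Matrix (Fin d) (Fin d) ℂ) * K * U) i i).re
      ≤ ∑ i, ∑ j, Complex.normSq ((M : Matrix (Fin d) (Fin d) ℂ) i j) *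
          Real.exp (hK.eigenvalues j) := by
        refine Finset.sum_le_sum fun i _ => ?_
        rw [conj_diag_re hK]
        exact convexOn_exp.map_sum_le (fun j _ => Complex.normSq_nonneg _) (sum_normSq_row M i)
          fun _ _ => Set.mem_univ _
    _ = reTr (mexp K) := by
        rw [Finset.sum_comm, reTr_mexp hK]
        exact Finset.sum_congr rfl fun j _ => by rw [← Finset.sum_mul, sum_normSq_col, one_mul]

/-- A form of Hölder's inequality for sums of exponentials. -/
lemma log_sum_exp_add_le {ι : Type*} [Fintype ι] [Nonempty ι] {k l : ι → ℝ} {a b A B : ℝ}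
    (ha : 0 ≤ a) (hb : 0 ≤ b) (hab : a + b = 1) (hA : 0 < A) (hB : 0 < B)
    (hk : ∑ i, Real.exp (k i) ≤ A) (hl : ∑ i, Real.exp (l i) ≤ B) :
    Real.log (∑ i, Real.exp (a * k i + b * l i)) ≤ a * Real.log A + b * Real.log B := by
  rw [Real.log_le_iff_le_exp (Finset.sum_pos (fun i _ => Real.exp_pos _) Finset.univ_nonempty)]
  set c := a * Real.log A + b * Real.log B with hc
  have key : ∑ i, Real.exp (a * k i + b * l i) * Real.exp (-c) ≤ 1 := by
    calc ∑ i, Real.exp (a * k i + b * l i) * Real.exp (-c)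
        ≤ ∑ i, (a * (Real.exp (k i) / A) + b * (Real.exp (l i) / B)) := by
          refine Finset.sum_le_sum fun i _ => ?_
          have h := convexOn_exp.2 (Set.mem_univ (k i - Real.log A))
            (Set.mem_univ (l i - Real.log B)) ha hb hab
          simp only [smul_eq_mul, Real.exp_sub, Real.exp_log hA, Real.exp_log hB] at h
          rw [← Real.exp_add]
          convert h using 2
          rw [hc]; ring
      _ = a * ((∑ i, Real.exp (k i)) / A) + b * ((∑ i, Real.exp (l i)) / B) := by
          rw [Finset.sum_add_distrib, ← Finset.mul_sum, ← Finset.mul_sum, Finset.sum_div,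
            Finset.sum_div]
      _ ≤ a * 1 + b * 1 := by
          gcongr
          · exact (div_le_one hA).2 hk
          · exact (div_le_one hB).2 hl
      _ = 1 := by linarith
  rwa [← Finset.sum_mul, Real.exp_neg, mul_inv_le_iff₀ (Real.exp_pos _), one_mul] at key

/-- The function `H ↦ log Tr exp H` is convex on Hermitian matrices. -/
lemma log_reTr_mexp_convex {d : ℕ} (hd : d ≠ 0) {K L : Matrix (Fin d) (Fin d) ℂ}
    (hK : K.IsHermitian) (hL : L.IsHermitian) {a b : ℝ} (ha : 0 ≤ a) (hb : 0 ≤ b)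
    (hab : a + b = 1) :
    Real.log (reTr (mexp ((a : ℂ) • K + (b : ℂ) • L))) ≤
      a * Real.log (reTr (mexp K)) + b * Real.log (reTr (mexp L)) := by
  have : NeZero d := ⟨hd⟩
  have hH : ((a : ℂ) • K + (b : ℂ) • L).IsHermitian :=
    (hK.smul (Complex.conj_ofReal a)).add (hL.smul (Complex.conj_ofReal b))
  set U := hH.eigenvectorUnitary
  have heig (i : Fin d) : hH.eigenvalues i =
      a * ((star (U : Matrix (Fin d) (Fin d) ℂ) * K * U) i i).re +
        b * ((star (U : Matrix (Fin d) (Fin d) ℂ) * L * U) i i).re := by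
    have h := congrArg Complex.re (congrFun (congrFun hH.conjStarAlgAut_star_eigenvectorUnitary i) i)
    rw [Unitary.conjStarAlgAut_star_apply] at h
    simpa [Matrix.mul_add, Matrix.add_mul, U] using h.symm
  rw [reTr_mexp hH]
  simp_rw [heig]
  exact log_sum_exp_add_le ha hb hab (reTr_mexp_pos hd hK) (reTr_mexp_pos hd hL)
    (sum_exp_conj_diag_le hK U) (sum_exp_conj_diag_le hL U)

/-- The perspective of `H ↦ log Tr exp H` along a line is convex. -/
lemma convexOn_perspective_log_reTr_mexp {d : ℕ} (hd : d ≠ 0) {A B : Matrix (Fin d) (Fin d) ℂ}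
    (hA : A.IsHermitian) (hB : B.IsHermitian) :
    ConvexOn ℝ (Set.Ici 0) fun s : ℝ =>
      (1 + s) * Real.log (reTr (mexp ((((1 + s)⁻¹ : ℝ) : ℂ) • (A + (s : ℂ) • B)))) := by
  refine ⟨convex_Ici 0, fun s hs t ht a b ha hb hab => ?_⟩
  rw [Set.mem_Ici] at hs ht
  simp only [smul_eq_mul]
  have hr : 0 < 1 + (a * s + b * t) := by positivity
  have hs' : 0 < 1 + s := by positivity
  have ht' : 0 < 1 + t := by positivity
  have herm (u : ℝ) : ((((1 + u)⁻¹ : ℝ) : ℂ) • (A + (u : ℂ) • B)).IsHermitian :=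
    (hA.add (hB.smul (Complex.conj_ofReal u))).smul (Complex.conj_ofReal _)
  set r := 1 + (a * s + b * t) with hr_def
  have hsum : a * (1 + s) + b * (1 + t) = r := by rw [hr_def]; linear_combination hab
  have key := log_reTr_mexp_convex hd (herm s) (herm t) (a := a * (1 + s) / r)
    (b := b * (1 + t) / r) (by positivity) (by positivity)
    (by rw [← add_div, hsum, div_self hr.ne'])
  have harg : ((r⁻¹ : ℝ) : ℂ) • (A + ((a * s + b * t : ℝ) : ℂ) • B) =
      ((a * (1 + s) / r : ℝ) : ℂ) • ((((1 + s)⁻¹ : ℝ) : ℂ) • (A + (s : ℂ) • B)) +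
        ((b * (1 + t) / r : ℝ) : ℂ) • ((((1 + t)⁻¹ : ℝ) : ℂ) • (A + (t : ℂ) • B)) := by
    have e1 : a * (1 + s) / r * (1 + s)⁻¹ = a * r⁻¹ := by field_simp
    have e2 : b * (1 + t) / r * (1 + t)⁻¹ = b * r⁻¹ := by field_simp
    rw [smul_smul, smul_smul, ← Complex.ofReal_mul, ← Complex.ofReal_mul, e1, e2]
    have hab' : (b : ℂ) = 1 - a := by
      rw [← Complex.ofReal_one, ← hab]
      push_cast
      ring
    push_cast
    rw [hab']
    module
  rw [harg]
  calc _ ≤ r * _ := mul_le_mul_of_nonneg_left key hr.le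
    _ = _ := by field_simp

/-- **Concavity of the log-Euclidean exponent function `Ẽ_h`.** -/
theorem EhTilde_concaveOn
    {X : Type} [Fintype X] {d : ℕ}
    (W : X → Matrix (Fin d) (Fin d) ℂ) (hW : ∀ x, (W x).PosDef ∧ (W x).trace = 1)
    (σ : Matrix (Fin d) (Fin d) ℂ) (hσ : σ.PosDef ∧ σ.trace = 1)
    (P : X → ℝ) (hP : IsProbDist P) :
    ConcaveOn ℝ (Set.Ici 0) (fun s => EhTilde W s P σ) := by
  have hd : d ≠ 0 := by
    rintro rfl
    simpa using hσ.2
  have hconv (x : X) := (convexOn_perspective_log_reTr_mexp hd (isHermitian_matFun Real.log (W x))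
    (isHermitian_matFun Real.log σ)).smul (hP.1 x)
  refine ⟨convex_Ici 0, fun s hs t ht a b ha hb hab => ?_⟩
  have heq (u : ℝ) : EhTilde W u P σ = -∑ x, P x • ((1 + u) * Real.log
      (reTr (mexp ((((1 + u)⁻¹ : ℝ) : ℂ) • (mlog (W x) + (u : ℂ) • mlog σ))))) := by
    rw [EhTilde, neg_mul, Finset.mul_sum]
    exact congrArg _ (Finset.sum_congr rfl fun x _ => mul_left_comm _ _ _)
  have h := Finset.sum_le_sum fun x (_ : x ∈ Finset.univ) => (hconv x).2 hs ht ha hb hab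
  rw [Finset.sum_add_distrib, ← Finset.smul_sum, ← Finset.smul_sum] at h
  simp only [heq, smul_neg, ← neg_add]
  exact neg_le_neg h

end MDQ
end
end
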